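/- Let Ω ⊆ ℝ³ \ {0} be open, let γ > 1, c_V > 0, π∞, μ, κ, g₀ be real constants, ω ∈ ℝ³ a constant vector, and let ρ, p, T : ℝ × Ω → ℝ and u : ℝ × Ω → ℝ³ be twice continuously differentiable with ρ > 0, p + π∞ > 0, T > 0 everywhere. Define e = c_V T + π∞/ρ, the viscous stress σ̂ = μ[∇u + (∇u)ᵀ − (2/3)(div u)·I], the gravity field g(x) = g₀ x/‖x‖, and E = ρe + (1/2)ρ‖u‖² + ρ g₀‖x‖. Assume the equation of state p = (γ−1)ρe − γπ∞ and the conservative system: ∂ₜρ + div(ρu) = 0; ∂ₜ(ρu) + div(ρ u ⊗ u) + ∇p + 2ρ(ω × u) + ρg − div σ̂ = 0; ∂ₜE + div((E + p)u) − div(κ∇T + σ̂u) = 0, all on ℝ × Ω. Then (p, u, T) satisfies the non-conservative system on ℝ × Ω: ∂ₜT + u·∇T + (γ−1)T·div u − ((γ−1)T/(p+π∞))·(div(κ∇T) + ∇u : σ̂) = 0; ∂ₜu + (u·∇)u + (1/ρ)∇p − (1/ρ)div σ̂ + g + 2(ω × u) = 0; ∂ₜp + u·∇p + γ(p+π∞)·div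 u − (γ−1)·div(κ∇T) − (γ−1)·(∇u : σ̂) = 0; and ρ = (p + π∞)/(c_V(γ−1)T). -/

import Mathlib

noncomputable section

/-- Spacetime: time `ℝ` times three-dimensional Euclidean space. -/
abbrev SpaceTime : Type := ℝ × EuclideanSpace ℝ (Fin 3)

/-- Time partial derivative `∂ₜ f` of a scalar field on spacetime. -/
def pdt (f : SpaceTime → ℝ) (q : SpaceTime) : ℝ :=
  fderiv ℝ f q (1, 0)

/-- Spatial partial derivative `∂ᵢ f` in the `i`-th coordinate direction. -/
def pd (i : Fin 3) (f : SpaceTime → ℝ) (q : SpaceTime) : ℝ :=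
  fderiv ℝ f q (0, EuclideanSpace.single i 1)

/-- Spatial divergence `div v = Σᵢ ∂ᵢ vᵢ` of a vector field given componentwise. -/
def sdiv (v : SpaceTime → Fin 3 → ℝ) (q : SpaceTime) : ℝ :=
  ∑ i, pd i (fun q => v q i) q

/-- Cross product of two vectors in `ℝ³`. -/
def cross (a b : Fin 3 → ℝ) : Fin 3 → ℝ :=
  ![a 1 * b 2 - a 2 * b 1, a 2 * b 0 - a 0 * b 2, a 0 * b 1 - a 1 * b 0]

/-- The viscous stress tensor `σ̂ = μ[∇u + (∇u)ᵀ − (2/3)(div u) I]`, componentwise. -/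
def stress (μ : ℝ) (u : SpaceTime → Fin 3 → ℝ) (q : SpaceTime) (i j : Fin 3) : ℝ :=
  μ * (pd j (fun q => u q i) q + pd i (fun q => u q j) q
    - (2 / 3) * sdiv u q * (if i = j then (1 : ℝ) else 0))

/-- The material derivative `∂ₜ f + u·∇f`, as a directional derivative on spacetime. -/
def materialDeriv (u : SpaceTime → Fin 3 → ℝ) (f : SpaceTime → ℝ) (q : SpaceTime) : ℝ :=
  fderiv ℝ f q (1, WithLp.toLp 2 (u q))

lemma pdt_add_sum_mul_pd (u : SpaceTime → Fin 3 → ℝ) (f : SpaceTime → ℝ) (q : SpaceTime) :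
    pdt f q + ∑ j, u q j * pd j f q = materialDeriv u f q := by
  have h : ((1, WithLp.toLp 2 (u q)) : SpaceTime)
      = (1, 0) + ∑ j, u q j • (0, EuclideanSpace.single j 1) := by
    refine Prod.ext ?_ ?_
    · simp [Prod.fst_sum]
    · ext k
      fin_cases k <;> simp [Fin.sum_univ_three]
  simp only [materialDeriv, pdt, pd, h, map_add, map_sum, map_smul, smul_eq_mul]

lemma materialDeriv_mul (u : SpaceTime → Fin 3 → ℝ) {f g : SpaceTime → ℝ} {q : SpaceTime}
    (hf : DifferentiableAt ℝ f q) (hg : DifferentiableAt ℝ g q) :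
    materialDeriv u (fun q => f q * g q) q
      = f q * materialDeriv u g q + g q * materialDeriv u f q := by
  simp [materialDeriv, fderiv_fun_mul hf hg]

lemma pd_mul (i : Fin 3) {f g : SpaceTime → ℝ} {q : SpaceTime}
    (hf : DifferentiableAt ℝ f q) (hg : DifferentiableAt ℝ g q) :
    pd i (fun q => f q * g q) q = f q * pd i g q + g q * pd i f q := by
  simp [pd, fderiv_fun_mul hf hg]

lemma pd_add (i : Fin 3) {f g : SpaceTime → ℝ} {q : SpaceTime}
    (hf : DifferentiableAt ℝ f q) (hg : DifferentiableAt ℝ g q) :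
    pd i (fun q => f q + g q) q = pd i f q + pd i g q := by
  simp [pd, fderiv_fun_add hf hg]

lemma pd_sum_mul (i : Fin 3) {f g : Fin 3 → SpaceTime → ℝ} {q : SpaceTime}
    (hf : ∀ k, DifferentiableAt ℝ (f k) q) (hg : ∀ k, DifferentiableAt ℝ (g k) q) :
    pd i (fun q => ∑ k, f k q * g k q) q
      = ∑ k, (f k q * pd i (g k) q + g k q * pd i (f k) q) := by
  simp only [← pd_mul i (hf _) (hg _)]
  simp only [pd]
  rw [fderiv_fun_sum fun k _ => (hf k).fun_mul (hg k), sum_apply]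

lemma sum_pd_mul {u : SpaceTime → Fin 3 → ℝ} {f : SpaceTime → ℝ} {q : SpaceTime}
    (hf : DifferentiableAt ℝ f q) (hu : ∀ j, DifferentiableAt ℝ (fun q => u q j) q) :
    ∑ j, pd j (fun q => f q * u q j) q = f q * sdiv u q + ∑ j, u q j * pd j f q := by
  simp only [pd_mul _ hf (hu _), Finset.sum_add_distrib, Finset.mul_sum, sdiv]

lemma differentiableAt_pd (i : Fin 3) {f : SpaceTime → ℝ} {q : SpaceTime}
    (hf : ContDiffAt ℝ 2 f q) : DifferentiableAt ℝ (pd i f) q :=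
  ((hf.fderiv_right (m := 1) (by norm_num)).differentiableAt one_ne_zero).clm_apply
    (differentiableAt_const _)

lemma stress_comm (μ : ℝ) (u : SpaceTime → Fin 3 → ℝ) (q : SpaceTime) (i j : Fin 3) :
    stress μ u q i j = stress μ u q j i := by
  simp only [stress, eq_comm (a := i), add_comm (pd j _ q)]

lemma differentiableAt_stress (μ : ℝ) {u : SpaceTime → Fin 3 → ℝ} {q : SpaceTime}
    (hu : ∀ i, ContDiffAt ℝ 2 (fun q => u q i) q) (i j : Fin 3) :
    DifferentiableAt ℝ (fun q => stress μ u q i j) q := by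
  have h (i j : Fin 3) : DifferentiableAt ℝ (pd i fun q => u q j) q :=
    differentiableAt_pd i (hu j)
  have hdiv : DifferentiableAt ℝ (sdiv u) q := DifferentiableAt.fun_sum fun k _ => h k k
  exact (((h j i).fun_add (h i j)).fun_sub ((hdiv.const_mul (2 / 3)).mul_const _)).const_mul μ

lemma materialDeriv_norm (u : SpaceTime → Fin 3 → ℝ) {q : SpaceTime} (hq : q.2 ≠ 0) :
    materialDeriv u (fun q => ‖q.2‖) q = ∑ i, u q i * (q.2 i / ‖q.2‖) := by
  have hn : ‖q.2‖ ≠ 0 := norm_ne_zero_iff.mpr hq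
  have hd : DifferentiableAt ℝ (fun q : SpaceTime => ‖q.2‖) q :=
    differentiableAt_snd.norm ℝ hq
  have h1 := materialDeriv_mul u hd hd
  have h2 : materialDeriv u (fun q => ‖q.2‖ * ‖q.2‖) q = 2 * ∑ i, u q i * q.2 i := by
    have := (hasFDerivAt_snd (𝕜 := ℝ) (p := q)).norm_sq
    simp only [← sq, materialDeriv]
    rw [this.fderiv]
    simp [PiLp.inner_apply]
  have h3 : ∑ i, u q i * (q.2 i / ‖q.2‖) = (∑ i, u q i * q.2 i) / ‖q.2‖ := by
    simp only [Finset.sum_div, mul_div_assoc]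
  rw [h3, eq_div_iff hn]
  linarith

lemma materialDeriv_specific_energy {u : SpaceTime → Fin 3 → ℝ} {T : SpaceTime → ℝ}
    {q : SpaceTime} (cV g₀ : ℝ) (hT : DifferentiableAt ℝ T q)
    (hu : ∀ i, DifferentiableAt ℝ (fun q => u q i) q) (hq : q.2 ≠ 0) :
    DifferentiableAt ℝ (fun q => cV * T q + (1 / 2) * (∑ i, (u q i) ^ 2) + g₀ * ‖q.2‖) q ∧
    materialDeriv u (fun q => cV * T q + (1 / 2) * (∑ i, (u q i) ^ 2) + g₀ * ‖q.2‖) q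
      = cV * materialDeriv u T q + ∑ i, u q i * materialDeriv u (fun q => u q i) q
        + g₀ * ∑ i, u q i * (q.2 i / ‖q.2‖) := by
  have hn : DifferentiableAt ℝ (fun q : SpaceTime => ‖q.2‖) q := differentiableAt_snd.norm ℝ hq
  have h := ((hT.hasFDerivAt.const_mul cV).fun_add ((HasFDerivAt.fun_sum (u := Finset.univ)
    fun i _ => (hu i).hasFDerivAt.pow 2).const_mul (1 / 2))).fun_add (hn.hasFDerivAt.const_mul g₀)
  refine ⟨h.differentiableAt, ?_⟩
  rw [← materialDeriv_norm u hq]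
  simp only [materialDeriv]
  rw [h.fderiv]
  simp [Fin.sum_univ_three]
  ring

lemma sdiv_heat_add_work (κ μ : ℝ) {u : SpaceTime → Fin 3 → ℝ} {T : SpaceTime → ℝ}
    {q : SpaceTime} (hT : ContDiffAt ℝ 2 T q) (hu : ∀ i, ContDiffAt ℝ 2 (fun q => u q i) q) :
    sdiv (fun q j => κ * pd j T q + ∑ i, stress μ u q j i * u q i) q
      = (∑ j, pd j (fun q => κ * pd j T q) q)
        + (∑ i, ∑ j, pd j (fun q => u q i) q * stress μ u q i j)
        + ∑ i, u q i * ∑ j, pd j (fun q => stress μ u q i j) q := by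
  have hud : ∀ i, DifferentiableAt ℝ (fun q => u q i) q :=
    fun i => (hu i).differentiableAt two_ne_zero
  have hσ := differentiableAt_stress μ hu
  have hpd (j : Fin 3) : pd j (fun q => κ * pd j T q + ∑ i, stress μ u q j i * u q i) q
      = pd j (fun q => κ * pd j T q) q + ∑ i, (stress μ u q i j * pd j (fun q => u q i) q
        + u q i * pd j (fun q => stress μ u q i j) q) := by
    simp only [stress_comm μ u _ j]
    rw [pd_add j ((differentiableAt_pd j hT).const_mul κ)
      (DifferentiableAt.fun_sum fun i _ => (hσ i j).fun_mul (hud i)),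
      pd_sum_mul j (fun i => hσ i j) hud]
  rw [sdiv, Finset.sum_congr rfl fun j _ => hpd j]
  simp only [Fin.sum_univ_three]
  ring


/-- **Appendix A: the conservative compressible Navier–Stokes system with the Stiffened Gas
equation of state implies the non-conservative system in the primitive variables `(p, u, T)`.**
With `e = c_V T + π∞/ρ`, `σ̂ = μ[∇u + (∇u)ᵀ − (2/3)(div u)I]`, `g(x) = g₀ x/‖x‖`,
`E = ρe + (1/2)ρ‖u‖² + ρg₀‖x‖`, and the equation of state `p = (γ−1)ρe − γπ∞`, the
conservative mass, momentum and energy equations on `ℝ × Ω` imply the non-conservative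
temperature, momentum and pressure equations together with `ρ = (p + π∞)/(c_V(γ−1)T)`. -/
theorem conservative_implies_nonconservative_system
    (Ω : Set (EuclideanSpace ℝ (Fin 3))) (hΩ : IsOpen Ω) (hΩ0 : ∀ x ∈ Ω, x ≠ 0)
    (γ cV piInf μ κ g₀ : ℝ) (hγ : 1 < γ) (hcV : 0 < cV) (ω : Fin 3 → ℝ)
    (ρ p T E : SpaceTime → ℝ) (u : SpaceTime → Fin 3 → ℝ)
    (hρ : ContDiffOn ℝ 2 ρ (Set.univ ×ˢ Ω))
    (hp : ContDiffOn ℝ 2 p (Set.univ ×ˢ Ω))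
    (hT : ContDiffOn ℝ 2 T (Set.univ ×ˢ Ω))
    (hu : ContDiffOn ℝ 2 u (Set.univ ×ˢ Ω))
    (hρpos : ∀ q ∈ Set.univ ×ˢ Ω, 0 < ρ q)
    (hppos : ∀ q ∈ Set.univ ×ˢ Ω, 0 < p q + piInf)
    (hTpos : ∀ q ∈ Set.univ ×ˢ Ω, 0 < T q)
    -- total energy `E = ρe + (1/2)ρ‖u‖² + ρg₀‖x‖` with `e = c_V T + π∞/ρ`
    (hEdef : ∀ q : SpaceTime,
      E q = ρ q * (cV * T q + piInf / ρ q)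
        + (1 / 2) * ρ q * (∑ i, (u q i) ^ 2) + ρ q * g₀ * ‖q.2‖)
    -- equation of state `p = (γ−1)ρe − γπ∞`
    (heos : ∀ q ∈ Set.univ ×ˢ Ω,
      p q = (γ - 1) * ρ q * (cV * T q + piInf / ρ q) - γ * piInf)
    -- conservative mass equation
    (hmass : ∀ q ∈ Set.univ ×ˢ Ω,
      pdt ρ q + sdiv (fun q i => ρ q * u q i) q = 0)
    -- conservative momentum equation
    (hmom : ∀ q ∈ Set.univ ×ˢ Ω, ∀ i,
      pdt (fun q => ρ q * u q i) q
        + (∑ j, pd j (fun q => ρ q * u q i * u q j) q)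
        + pd i p q + 2 * (ρ q * cross ω (u q) i) + ρ q * (g₀ * q.2 i / ‖q.2‖)
        - (∑ j, pd j (fun q => stress μ u q i j) q) = 0)
    -- conservative energy equation
    (hener : ∀ q ∈ Set.univ ×ˢ Ω,
      pdt E q + sdiv (fun q j => (E q + p q) * u q j) q
        - sdiv (fun q j => κ * pd j T q + ∑ i, stress μ u q j i * u q i) q = 0) :
    ∀ q ∈ Set.univ ×ˢ Ω,
      -- non-conservative temperature equation
      (pdt T q + (∑ i, u q i * pd i T q) + (γ - 1) * T q * sdiv u q
        - ((γ - 1) * T q / (p q + piInf)) *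
            ((∑ j, pd j (fun q => κ * pd j T q) q)
              + (∑ i, ∑ j, pd j (fun q => u q i) q * stress μ u q i j)) = 0)
      -- non-conservative momentum equation
      ∧ (∀ i,
        pdt (fun q => u q i) q
          + (∑ j, u q j * pd j (fun q => u q i) q)
          + (1 / ρ q) * pd i p q
          - (1 / ρ q) * (∑ j, pd j (fun q => stress μ u q i j) q)
          + g₀ * q.2 i / ‖q.2‖ + 2 * cross ω (u q) i = 0)
      -- non-conservative pressure equation
      ∧ (pdt p q + (∑ i, u q i * pd i p q) + γ * (p q + piInf) * sdiv u q
          - (γ - 1) * (∑ j, pd j (fun q => κ * pd j T q) q)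
          - (γ - 1) * (∑ i, ∑ j, pd j (fun q => u q i) q * stress μ u q i j) = 0)
      -- equation of state in density form
      ∧ ρ q = (p q + piInf) / (cV * (γ - 1) * T q) := by
  intro q hq
  have hnhds : Set.univ ×ˢ Ω ∈ nhds q := (isOpen_univ.prod hΩ).mem_nhds hq
  have hx : q.2 ≠ 0 := hΩ0 _ hq.2
  have hρq := (hρpos q hq).ne'
  have hTq := (hTpos q hq).ne'
  have hγ' : γ - 1 ≠ 0 := by linarith
  have hρd : DifferentiableAt ℝ ρ q := (hρ.contDiffAt hnhds).differentiableAt two_ne_zero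
  have hpd : DifferentiableAt ℝ p q := (hp.contDiffAt hnhds).differentiableAt two_ne_zero
  have hT2 : ContDiffAt ℝ 2 T q := hT.contDiffAt hnhds
  have hTd : DifferentiableAt ℝ T q := hT2.differentiableAt two_ne_zero
  have hu2 : ∀ i, ContDiffAt ℝ 2 (fun q => u q i) q := contDiffAt_pi.mp (hu.contDiffAt hnhds)
  have hud : ∀ i, DifferentiableAt ℝ (fun q => u q i) q :=
    fun i => (hu2 i).differentiableAt two_ne_zero
  have heos' : ∀ q ∈ Set.univ ×ˢ Ω, p q = (γ - 1) * cV * (ρ q * T q) - piInf := by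
    intro q hq
    have := (hρpos q hq).ne'
    rw [heos q hq]
    field_simp
    ring
  have hmass' : materialDeriv u ρ q = -(ρ q * sdiv u q) := by
    have := hmass q hq
    rw [sdiv, sum_pd_mul hρd hud] at this
    rw [← pdt_add_sum_mul_pd]
    linarith
  have hmom' (i : Fin 3) : ρ q * materialDeriv u (fun q => u q i) q + pd i p q
      + 2 * (ρ q * cross ω (u q) i) + ρ q * (g₀ * q.2 i / ‖q.2‖)
      - (∑ j, pd j (fun q => stress μ u q i j) q) = 0 := by
    have h := hmom q hq i
    rw [sum_pd_mul (hρd.fun_mul (hud i)) hud] at h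
    have h1 := pdt_add_sum_mul_pd u (fun q => ρ q * u q i) q
    rw [materialDeriv_mul u hρd (hud i), hmass'] at h1
    linear_combination h - h1
  have hpres : materialDeriv u p q
      = (γ - 1) * cV * (ρ q * materialDeriv u T q - T q * (ρ q * sdiv u q)) := by
    have h : p =ᶠ[nhds q] fun q => (γ - 1) * cV * (ρ q * T q) - piInf :=
      Filter.eventuallyEq_of_mem hnhds heos'
    have h1 := materialDeriv_mul u hρd hTd
    rw [hmass'] at h1
    have h2 : materialDeriv u p q
        = (γ - 1) * cV * materialDeriv u (fun q => ρ q * T q) q := by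
      simp only [materialDeriv]
      rw [h.fderiv_eq, fderiv_sub_const, fderiv_const_mul (hρd.fun_mul hTd)]
      rfl
    rw [h2, h1]
    ring
  obtain ⟨hεd, hε⟩ := materialDeriv_specific_energy cV g₀ hTd hud hx
  set ε : SpaceTime → ℝ :=
    fun q => cV * T q + (1 / 2) * (∑ i, (u q i) ^ 2) + g₀ * ‖q.2‖ with hεdef
  have hE : ∀ q ∈ Set.univ ×ˢ Ω, E q = ρ q * ε q + piInf := by
    intro q hq
    have := (hρpos q hq).ne'
    rw [hEdef q, hεdef]
    field_simp
    ring
  have hEev : E =ᶠ[nhds q] fun q => ρ q * ε q + piInf := Filter.eventuallyEq_of_mem hnhds hE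
  have hEd : DifferentiableAt ℝ E q :=
    ((hρd.mul hεd).add_const piInf).congr_of_eventuallyEq hEev
  have hEmat : materialDeriv u E q = ρ q * materialDeriv u ε q - ε q * (ρ q * sdiv u q) := by
    have h1 := materialDeriv_mul u hρd hεd
    rw [hmass'] at h1
    rw [materialDeriv, hEev.fderiv_eq, fderiv_add_const]
    exact h1.trans (by ring)
  have hint : ρ q * cV * materialDeriv u T q + (p q + piInf) * sdiv u q
      = (∑ j, pd j (fun q => κ * pd j T q) q)
        + (∑ i, ∑ j, pd j (fun q => u q i) q * stress μ u q i j) := by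
    have h := hener q hq
    have hdiv : sdiv (fun q j => (E q + p q) * u q j) q = (E q + p q) * sdiv u q
        + ∑ j, u q j * pd j E q + ∑ j, u q j * pd j p q := by
      rw [sdiv, sum_pd_mul (hEd.fun_add hpd) hud, add_assoc, ← Finset.sum_add_distrib]
      simp only [pd_add _ hEd hpd, mul_add]
    have hEm := pdt_add_sum_mul_pd u E q
    rw [hEmat, hε] at hEm
    rw [hdiv, sdiv_heat_add_work κ μ hT2 hu2, hE q hq] at h
    have h0 := hmom' 0
    have h1 := hmom' 1
    have h2 := hmom' 2
    simp only [cross, Matrix.cons_val] at h0 h1 h2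
    generalize (∑ j, pd j (fun q => κ * pd j T q) q) = K at *
    generalize (∑ i, ∑ j, pd j (fun q => u q i) q * stress μ u q i j) = Φ at *
    simp only [Fin.sum_univ_three] at h h0 h1 h2 hEm
    linear_combination h - hEm - u q 0 * h0 - u q 1 * h1 - u q 2 * h2
  generalize (∑ j, pd j (fun q => κ * pd j T q) q) = K at *
  generalize (∑ i, ∑ j, pd j (fun q => u q i) q * stress μ u q i j) = Φ at *
  have hPq : p q + piInf = (γ - 1) * cV * (ρ q * T q) := by rw [heos' q hq]; ring
  rw [pdt_add_sum_mul_pd, pdt_add_sum_mul_pd]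
  refine ⟨?_, fun i => ?_, ?_, ?_⟩
  · rw [← hint, hPq]
    field_simp
    ring
  · rw [pdt_add_sum_mul_pd]
    have h := hmom' i
    field_simp
    field_simp at h
    linear_combination h
  · rw [hpres]
    linear_combination (γ - 1) * hint + sdiv u q * hPq
  · rw [hPq]
    field_simp

end
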